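/- arXiv:1409.1511 — 2 statements merged into one kernel-verified Lean document; each statement's English description precedes it below -/
import Mathlib

section
/- Let u and v be positive rational numbers and let a = x/y with x, y positive integers satisfying y² < x. Then the Tasoev continued fraction T₁(u,v,a) = 1/(ua) + 1/(va²) + 1/(ua³) + 1/(va⁴) + ⋯ (a continued fraction with all partial numerators equal to 1 and partial denominators b_{2k-1} = u·a^{2k-1}, b_{2k} = v·a^{2k} for k ≥ 1) converges to an irrational number, and μ_I(T₁(u,v,a)) ≤ 2 + (2 log y)/(log x − 2 log y). -/
open Filter

/-- The asymptotic irrationality exponent: the infimum (in `EReal`, so that the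
infimum of the empty set is `∞`) of all real `μ` for which there exist `c > 0`
and `N₀ > 0` with `|τ - M/N| ≥ c / N ^ μ` for all integers `M, N` with `N ≥ N₀`. -/
noncomputable def muI (τ : ℝ) : EReal :=
  sInf ((fun μ : ℝ => (μ : EReal)) ''
    {μ : ℝ | ∃ c > (0:ℝ), ∃ N₀ > (0:ℝ), ∀ M N : ℤ,
      (N : ℝ) ≥ N₀ → |τ - (M : ℝ) / (N : ℝ)| ≥ c / (N : ℝ) ^ μ})

/-- Numerators of the convergents of the generalized continued fraction
`K_{n=1}^∞ a n / b n` with rational partial coefficients. -/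
def cfAQ (a b : ℕ → ℚ) : ℕ → ℚ
  | 0 => 0
  | 1 => a 1
  | (n + 2) => b (n + 2) * cfAQ a b (n + 1) + a (n + 2) * cfAQ a b n

/-- Denominators of the convergents of the generalized continued fraction
`K_{n=1}^∞ a n / b n` with rational partial coefficients. -/
def cfBQ (a b : ℕ → ℚ) : ℕ → ℚ
  | 0 => 1
  | 1 => b 1
  | (n + 2) => b (n + 2) * cfBQ a b (n + 1) + a (n + 2) * cfBQ a b n

lemma tendsto_quadratic_div_sq {m : ℝ → ℝ} {s : ℝ}
    (hm : Tendsto (fun t => m t / t) atTop (nhds s)) (g c d : ℝ) :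
    Tendsto (fun t => (g * m t ^ 2 + c * m t + d) / t ^ 2) atTop (nhds (g * s ^ 2)) := by
  have hinv : Tendsto (fun t : ℝ => t⁻¹) atTop (nhds 0) := tendsto_inv_atTop_zero
  have h := (((hm.pow 2).const_mul g).add ((hm.mul hinv).const_mul c)).add
    ((hinv.pow 2).const_mul d)
  have h' : g * s ^ 2 + c * (s * 0) + d * 0 ^ 2 = g * s ^ 2 := by ring
  rw [h'] at h
  refine h.congr' ?_
  filter_upwards [eventually_gt_atTop 0] with t ht
  field_simp

/-- Integer linear forms `q n * τ - p n` with quadratic-exponential size bounds and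
nonvanishing consecutive determinants give a lower bound for rational approximation. -/
lemma exists_lower_bound_of_linear_forms {τ α β c d e f μ : ℝ} (hα : 0 < α) (hβ : 0 < β)
    (p q : ℕ → ℤ) (hdet : ∀ n, p n * q (n + 1) ≠ p (n + 1) * q n)
    (hq : ∀ n : ℕ, |(q n : ℝ)| ≤ Real.exp (α * (n : ℝ) ^ 2 + c * n + d))
    (herr : ∀ n : ℕ, |(q n : ℝ) * τ - p n| ≤ Real.exp (-(β * (n : ℝ) ^ 2) + e * n + f))
    (hμ : 1 + α / β < μ) :
    ∃ N₀ > (0 : ℝ), ∀ M N : ℤ, (N : ℝ) ≥ N₀ →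
      |τ - (M : ℝ) / (N : ℝ)| ≥ 1 / (N : ℝ) ^ μ := by
  have hr : 1 / β < (μ - 1) / α := by
    rw [div_lt_div_iff₀ hβ hα]
    have : α / β < μ - 1 := by linarith
    rw [div_lt_iff₀ hβ] at this
    linarith
  obtain ⟨r, hr1, hr2⟩ := exists_between hr
  have hr0 : 0 < r := lt_trans (by positivity) hr1
  set s := √r with hs
  have hs2 : s ^ 2 = r := Real.sq_sqrt hr0.le
  have hs0 : 0 < s := Real.sqrt_pos.2 hr0
  have hm0 : Tendsto (fun t : ℝ => ((⌈s * t⌉₊ : ℕ) : ℝ) / t) atTop (nhds s) :=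
    tendsto_nat_ceil_mul_div_atTop hs0.le
  have hm : ∀ k : ℕ, Tendsto (fun t : ℝ => ((⌈s * t⌉₊ + k : ℕ) : ℝ) / t) atTop (nhds s) := by
    intro k
    have h := hm0.add ((tendsto_inv_atTop_zero (𝕜 := ℝ)).const_mul (k : ℝ))
    rw [mul_zero, add_zero] at h
    refine h.congr fun t => ?_
    push_cast
    ring
  have hup : ∀ k : ℕ, ∀ᶠ t : ℝ in atTop,
      α * ((⌈s * t⌉₊ + k : ℕ) : ℝ) ^ 2 + c * ((⌈s * t⌉₊ + k : ℕ) : ℝ) + (d + Real.log 2)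
        ≤ (μ - 1) * t ^ 2 := by
    intro k
    have h := tendsto_quadratic_div_sq (hm k) α c (d + Real.log 2)
    have hlt : α * s ^ 2 < μ - 1 := by
      rw [hs2]
      rw [lt_div_iff₀ hα] at hr2
      linarith
    filter_upwards [h.eventually_lt_const hlt, eventually_gt_atTop 0] with t ht ht0
    rw [div_lt_iff₀ (by positivity)] at ht
    exact ht.le
  have hlow : ∀ k : ℕ, ∀ᶠ t : ℝ in atTop,
      1 * t ^ 2 ≤ β * ((⌈s * t⌉₊ + k : ℕ) : ℝ) ^ 2 + (-e) * ((⌈s * t⌉₊ + k : ℕ) : ℝ)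
        + (-f - Real.log 2) := by
    intro k
    have h := tendsto_quadratic_div_sq (hm k) β (-e) (-f - Real.log 2)
    have hlt : 1 < β * s ^ 2 := by
      rw [hs2]
      rw [div_lt_iff₀ hβ] at hr1
      linarith
    filter_upwards [h.eventually_const_lt hlt, eventually_gt_atTop 0] with t ht ht0
    rw [lt_div_iff₀ (by positivity)] at ht
    exact ht.le
  have hall := ((hup 0).and (hup 1)).and ((hlow 0).and (hlow 1))
  have hsq : Tendsto (fun N : ℝ => √(Real.log N)) atTop atTop :=
    Real.tendsto_sqrt_atTop.comp Real.tendsto_log_atTop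
  obtain ⟨N₁, hN₁⟩ := eventually_atTop.1 (hsq.eventually hall)
  refine ⟨max N₁ 1, by positivity, fun M N hN => ?_⟩
  have hN1 : (1 : ℝ) ≤ N := le_trans (le_max_right _ _) hN
  have hN0 : (0 : ℝ) < N := by linarith
  have hNz : N ≠ 0 := by
    rintro rfl
    simp at hN0
  have ht2 : √(Real.log N) ^ 2 = Real.log N := Real.sq_sqrt (Real.log_nonneg hN1)
  obtain ⟨⟨hu0, hu1⟩, hl0, hl1⟩ := hN₁ N (le_trans (le_max_left _ _) hN)
  rw [ht2] at hu0 hu1 hl0 hl1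
  have key : ∀ m : ℕ, M * q m ≠ N * p m →
      α * (m : ℝ) ^ 2 + c * m + (d + Real.log 2) ≤ (μ - 1) * Real.log N →
      1 * Real.log N ≤ β * (m : ℝ) ^ 2 + (-e) * m + (-f - Real.log 2) →
      |τ - (M : ℝ) / (N : ℝ)| ≥ 1 / (N : ℝ) ^ μ := by
    intro m hne hu hl
    have hq' : |(q m : ℝ)| * 2 ≤ (N : ℝ) ^ (μ - 1) := by
      rw [Real.rpow_def_of_pos hN0]
      calc |(q m : ℝ)| * 2 ≤ Real.exp (α * (m : ℝ) ^ 2 + c * m + d) * Real.exp (Real.log 2) := by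
            rw [Real.exp_log two_pos]
            have := hq m
            gcongr
        _ ≤ _ := by
            rw [← Real.exp_add]
            apply Real.exp_le_exp.2
            linarith
    have he' : (N : ℝ) * |(q m : ℝ) * τ - p m| * 2 ≤ 1 := by
      calc (N : ℝ) * |(q m : ℝ) * τ - p m| * 2
          ≤ Real.exp (Real.log N) * Real.exp (-(β * (m : ℝ) ^ 2) + e * m + f)
            * Real.exp (Real.log 2) := by
            rw [Real.exp_log two_pos, Real.exp_log hN0]
            have := herr m
            gcongr
        _ ≤ 1 := by
            rw [← Real.exp_add, ← Real.exp_add]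
            apply Real.exp_le_one_iff.2
            linarith
    have h1 : (1 : ℝ) ≤ |(M : ℝ) * q m - N * p m| := by
      have : 1 ≤ |M * q m - N * p m| := Int.one_le_abs (sub_ne_zero.2 hne)
      exact_mod_cast this
    have h2 : |(M : ℝ) * q m - N * p m| ≤
        N * |(q m : ℝ) * τ - p m| + |(q m : ℝ)| * (N * |τ - (M : ℝ) / N|) := by
      have : (M : ℝ) * q m - N * p m =
          N * ((q m : ℝ) * τ - p m) - q m * (N * (τ - (M : ℝ) / N)) := by
        field_simp
        ring
      rw [this]
      refine (abs_sub _ _).trans ?_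
      rw [abs_mul, abs_mul, abs_mul, abs_of_pos hN0]
    have h3 : |(q m : ℝ)| * 2 * (N * |τ - (M : ℝ) / N|) ≤
        (N : ℝ) ^ (μ - 1) * (N * |τ - (M : ℝ) / N|) := by gcongr
    have h4 : (N : ℝ) ^ μ = (N : ℝ) ^ (μ - 1) * N := by
      rw [← Real.rpow_add_one hN0.ne', sub_add_cancel]
    rw [ge_iff_le, div_le_iff₀ (by positivity), h4]
    linarith
  by_cases h : M * q ⌈s * √(Real.log N)⌉₊ = N * p ⌈s * √(Real.log N)⌉₊
  · refine key (⌈s * √(Real.log N)⌉₊ + 1) (fun h' => ?_) hu1 hl1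
    apply hdet ⌈s * √(Real.log N)⌉₊
    apply mul_left_cancel₀ hNz
    linear_combination (q ⌈s * √(Real.log N)⌉₊) * h' - (q (⌈s * √(Real.log N)⌉₊ + 1)) * h
  · exact key (⌈s * √(Real.log N)⌉₊ + 0) h hu0 hl0

lemma irrational_of_lower_bound {τ μ : ℝ}
    (h : ∃ N₀ > (0 : ℝ), ∀ M N : ℤ, (N : ℝ) ≥ N₀ →
      |τ - (M : ℝ) / (N : ℝ)| ≥ 1 / (N : ℝ) ^ μ) : Irrational τ := by
  rintro ⟨r, rfl⟩
  obtain ⟨N₀, hN₀, h⟩ := h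
  obtain ⟨k, hk⟩ := exists_nat_ge N₀
  have hk0 : (0 : ℝ) < k := lt_of_lt_of_le hN₀ hk
  have hd : (1 : ℝ) ≤ r.den := by exact_mod_cast r.pos
  have hkd : (k : ℝ) ≤ k * r.den := le_mul_of_one_le_right hk0.le hd
  have := h (k * r.num) (k * r.den) (by push_cast; linarith)
  have hz : ((r : ℚ) : ℝ) - ((k * r.num : ℤ) : ℝ) / ((k * r.den : ℤ) : ℝ) = 0 := by
    rw [sub_eq_zero]
    push_cast
    rw [mul_div_mul_left _ _ hk0.ne', Rat.cast_def]
  rw [hz, abs_zero] at this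
  have hpos : (0 : ℝ) < 1 / ((k * r.den : ℤ) : ℝ) ^ μ := by
    have : (0 : ℝ) < ((k * r.den : ℤ) : ℝ) := by push_cast; positivity
    positivity
  linarith

lemma cf_pos {b : ℕ → ℚ} (hb : ∀ n, 0 < b n) : ∀ n, 0 < cfBQ (fun _ => 1) b n
  | 0 => by simp [cfBQ]
  | 1 => by simpa [cfBQ] using hb 1
  | (n + 2) => by
    have := cf_pos hb n
    have := cf_pos hb (n + 1)
    have := hb (n + 2)
    rw [cfBQ]
    positivity

lemma cf_det (b : ℕ → ℚ) (n : ℕ) :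
    cfAQ (fun _ => 1) b (n + 1) * cfBQ (fun _ => 1) b n
      - cfAQ (fun _ => 1) b n * cfBQ (fun _ => 1) b (n + 1) = (-1) ^ n := by
  induction n with
  | zero => simp [cfAQ, cfBQ]
  | succ n ih =>
    rw [cfAQ, cfBQ, pow_succ, ← ih]
    ring

lemma cf_cross_le {b : ℕ → ℚ} (hb : ∀ n, 0 < b n) (n : ℕ) : ∀ k,
    |cfAQ (fun _ => 1) b (n + k) * cfBQ (fun _ => 1) b n
      - cfAQ (fun _ => 1) b n * cfBQ (fun _ => 1) b (n + k)| * cfBQ (fun _ => 1) b (n + 1)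
      ≤ cfBQ (fun _ => 1) b (n + k)
  | 0 => by
    simpa using (cf_pos hb n).le
  | 1 => by
    rw [cf_det, abs_pow, abs_neg, abs_one, one_pow, one_mul]
  | (k + 2) => by
    have h0 := cf_cross_le hb n k
    have h1 := cf_cross_le hb n (k + 1)
    have hB := cf_pos hb (n + 1)
    have hbk := hb (n + k + 2)
    rw [← add_assoc] at h1 ⊢
    rw [cfAQ, cfBQ]
    set X := cfAQ (fun _ => 1) b (n + k + 1) * cfBQ (fun _ => 1) b n
      - cfAQ (fun _ => 1) b n * cfBQ (fun _ => 1) b (n + k + 1) with hX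
    set Y := cfAQ (fun _ => 1) b (n + k) * cfBQ (fun _ => 1) b n
      - cfAQ (fun _ => 1) b n * cfBQ (fun _ => 1) b (n + k) with hY
    have hrec : (b (n + k + 2) * cfAQ (fun _ => 1) b (n + k + 1) + 1 * cfAQ (fun _ => 1) b (n + k))
        * cfBQ (fun _ => 1) b n - cfAQ (fun _ => 1) b n *
        (b (n + k + 2) * cfBQ (fun _ => 1) b (n + k + 1) + 1 * cfBQ (fun _ => 1) b (n + k))
        = b (n + k + 2) * X + Y := by
      rw [hX, hY]
      ring
    rw [hrec]
    calc |b (n + k + 2) * X + Y| * cfBQ (fun _ => 1) b (n + 1)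
        ≤ (b (n + k + 2) * |X| + |Y|) * cfBQ (fun _ => 1) b (n + 1) := by
          gcongr
          refine (abs_add_le _ _).trans ?_
          rw [abs_mul, abs_of_pos hbk]
      _ = b (n + k + 2) * (|X| * cfBQ (fun _ => 1) b (n + 1))
          + |Y| * cfBQ (fun _ => 1) b (n + 1) := by ring
      _ ≤ _ := by
          rw [one_mul]
          gcongr

lemma cf_sub_le {b : ℕ → ℚ} (hb : ∀ n, 0 < b n) {n m : ℕ} (hnm : n ≤ m) :
    |cfAQ (fun _ => 1) b m / cfBQ (fun _ => 1) b m
      - cfAQ (fun _ => 1) b n / cfBQ (fun _ => 1) b n|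
      ≤ 1 / (cfBQ (fun _ => 1) b n * cfBQ (fun _ => 1) b (n + 1)) := by
  obtain ⟨k, rfl⟩ := Nat.exists_eq_add_of_le hnm
  have h := cf_cross_le hb n k
  have h0 := cf_pos hb n
  have h1 := cf_pos hb (n + 1)
  have h2 := cf_pos hb (n + k)
  rw [div_sub_div _ _ h2.ne' h0.ne', abs_div, abs_of_pos (mul_pos h2 h0),
    div_le_div_iff₀ (by positivity) (by positivity),
    mul_comm (cfBQ (fun _ => 1) b (n + k)) (cfAQ _ _ n)]
  calc _ = cfBQ (fun _ => 1) b n * (_ * cfBQ (fun _ => 1) b (n + 1)) := by ring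
    _ ≤ cfBQ (fun _ => 1) b n * cfBQ (fun _ => 1) b (n + k) := by gcongr
    _ = _ := by ring

/-- A continued fraction with positive rational partial denominators converges as soon as the
products of consecutive denominators of its convergents tend to infinity. -/
lemma cf_exists_limit {b : ℕ → ℚ} (hb : ∀ n, 0 < b n)
    (hB : Tendsto (fun n => (cfBQ (fun _ => 1) b n * cfBQ (fun _ => 1) b (n + 1) : ℝ))
      atTop atTop) :
    ∃ τ : ℝ, Tendsto (fun n => (cfAQ (fun _ => 1) b n : ℝ) / (cfBQ (fun _ => 1) b n : ℝ))
        atTop (nhds τ) ∧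
      ∀ n, |(cfBQ (fun _ => 1) b n : ℝ) * τ - cfAQ (fun _ => 1) b n|
        ≤ 1 / cfBQ (fun _ => 1) b (n + 1) := by
  have hle : ∀ n m : ℕ, n ≤ m →
      |(cfAQ (fun _ => 1) b m : ℝ) / (cfBQ (fun _ => 1) b m : ℝ)
        - (cfAQ (fun _ => 1) b n : ℝ) / (cfBQ (fun _ => 1) b n : ℝ)|
      ≤ 1 / (cfBQ (fun _ => 1) b n * cfBQ (fun _ => 1) b (n + 1) : ℝ) := by
    intro n m hnm
    exact_mod_cast (Rat.cast_le (K := ℝ)).2 (cf_sub_le hb hnm)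
  have hcauchy : CauchySeq
      (fun n => (cfAQ (fun _ => 1) b n : ℝ) / (cfBQ (fun _ => 1) b n : ℝ)) := by
    refine cauchySeq_of_le_tendsto_0' _ (fun n m hnm => ?_) (hB.const_div_atTop 1)
    rw [dist_comm]
    exact hle n m hnm
  obtain ⟨τ, hτ⟩ := cauchySeq_tendsto_of_complete hcauchy
  refine ⟨τ, hτ, fun n => ?_⟩
  have h0 : (0 : ℝ) < cfBQ (fun _ => 1) b n := by exact_mod_cast cf_pos hb n
  have h1 : (0 : ℝ) < cfBQ (fun _ => 1) b (n + 1) := by exact_mod_cast cf_pos hb (n + 1)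
  have hlim := le_of_tendsto ((hτ.sub_const
    ((cfAQ (fun _ => 1) b n : ℝ) / (cfBQ (fun _ => 1) b n : ℝ))).abs)
    ((eventually_ge_atTop n).mono fun m hm => hle n m hm)
  have heq : (cfBQ (fun _ => 1) b n : ℝ) * τ - cfAQ (fun _ => 1) b n =
      cfBQ (fun _ => 1) b n *
        (τ - (cfAQ (fun _ => 1) b n : ℝ) / (cfBQ (fun _ => 1) b n : ℝ)) := by
    field_simp
  rw [heq, abs_mul, abs_of_pos h0]
  calc _ ≤ (cfBQ (fun _ => 1) b n : ℝ) *
        (1 / (cfBQ (fun _ => 1) b n * cfBQ (fun _ => 1) b (n + 1) : ℝ)) := by gcongr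
    _ = _ := by field_simp

/-- The `n`-th triangular number. -/
def tri : ℕ → ℕ
  | 0 => 0
  | (n + 1) => tri n + (n + 1)

lemma tri_cast (n : ℕ) : (tri n : ℝ) = ((n : ℝ) ^ 2 + n) / 2 := by
  induction n with
  | zero => simp [tri]
  | succ n ih =>
    rw [tri]
    push_cast
    rw [ih]
    ring

lemma recurrence_integral {b f : ℕ → ℚ} (hf : ∀ n, f (n + 2) = b (n + 2) * f (n + 1) + 1 * f n)
    {D y : ℕ} (hb : ∀ n, ∃ z : ℤ, (D : ℚ) * y ^ n * b n = z)
    (h0 : ∃ z : ℤ, f 0 = z) (h1 : ∃ z : ℤ, (D : ℚ) * y * f 1 = z) :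
    ∀ n, ∃ z : ℤ, (D : ℚ) ^ n * y ^ tri n * f n = z
  | 0 => by simpa [tri] using h0
  | 1 => by simpa [tri] using h1
  | (n + 2) => by
    obtain ⟨z0, hz0⟩ := recurrence_integral hf hb h0 h1 n
    obtain ⟨z1, hz1⟩ := recurrence_integral hf hb h0 h1 (n + 1)
    obtain ⟨w, hw⟩ := hb (n + 2)
    refine ⟨w * z1 + D ^ 2 * y ^ (2 * n + 3) * z0, ?_⟩
    push_cast
    rw [← hz0, ← hz1, ← hw, hf, tri, tri]
    ring

lemma cf_le_pow {b : ℕ → ℚ} {a W : ℚ} (ha : 1 ≤ a) (hW : 0 ≤ W)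
    (hb0 : ∀ n, 0 < b n) (hb : ∀ n, b n ≤ W * a ^ n) :
    ∀ n, cfBQ (fun _ => 1) b n ≤ (W + 1) ^ n * a ^ tri n
  | 0 => by simp [cfBQ, tri]
  | 1 => by
    have := hb 1
    simp only [cfBQ, tri, pow_one, zero_add] at this ⊢
    nlinarith
  | (n + 2) => by
    have h0 := cf_le_pow ha hW hb0 hb n
    have h1 := cf_le_pow ha hW hb0 hb (n + 1)
    have hp := cf_pos hb0 (n + 1)
    rw [cfBQ]
    have hle : (W + 1) ^ n * a ^ tri n ≤ (W + 1) ^ (n + 1) * a ^ tri (n + 2) := by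
      have : tri n ≤ tri (n + 2) := by simp only [tri]; omega
      gcongr
      · linarith
      · omega
    calc _ ≤ (W * a ^ (n + 2)) * ((W + 1) ^ (n + 1) * a ^ tri (n + 1))
          + 1 * ((W + 1) ^ (n + 1) * a ^ tri (n + 2)) := by
          have := hb (n + 2)
          gcongr
          exact h0.trans hle
      _ = _ := by
          rw [show tri (n + 2) = tri (n + 1) + (n + 2) from rfl]
          ring

lemma pow_le_cf {b : ℕ → ℚ} {a w : ℚ} (ha : 0 ≤ a) (hw : 0 ≤ w)
    (hb0 : ∀ n, 0 < b n) (hb : ∀ n, w * a ^ n ≤ b n) (n : ℕ) :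
    w ^ n * a ^ tri n ≤ cfBQ (fun _ => 1) b n := by
  induction n with
  | zero => simp [cfBQ, tri]
  | succ n ih =>
    have hle : b (n + 1) * cfBQ (fun _ => 1) b n ≤ cfBQ (fun _ => 1) b (n + 1) := by
      cases n with
      | zero => simp [cfBQ]
      | succ n =>
        rw [cfBQ.eq_3]
        have := cf_pos hb0 n
        linarith
    refine le_trans ?_ hle
    calc w ^ (n + 1) * a ^ tri (n + 1) = (w * a ^ (n + 1)) * (w ^ n * a ^ tri n) := by
          rw [tri]
          ring
      _ ≤ _ := by
          have := hb (n + 1)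
          have := hb0 (n + 1)
          gcongr

/-- Tasoev's continued fraction
`T₁(u,v,a) = 1/(ua) + 1/(va²) + 1/(ua³) + ⋯` (all partial numerators `1`,
partial denominators `u·aⁿ` for odd `n` and `v·aⁿ` for even `n`) with
`a = x/y`, `y² < x`, converges to an irrational number with
`μ_I ≤ 2 + 2 log y / (log x - 2 log y)`. -/
theorem tasoev_T1_muI_le
    (u v : ℚ) (hu : 0 < u) (hv : 0 < v)
    (x y : ℕ) (hx : 1 ≤ x) (hy : 1 ≤ y) (hxy : y ^ 2 < x) :
    ∃ τ : ℝ,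
      Tendsto (fun n =>
          ((cfAQ (fun _ => 1)
              (fun n => (if Odd n then u else v) * ((x : ℚ) / (y : ℚ)) ^ n) n : ℝ) /
           (cfBQ (fun _ => 1)
              (fun n => (if Odd n then u else v) * ((x : ℚ) / (y : ℚ)) ^ n) n : ℝ)))
        atTop (nhds τ) ∧
      Irrational τ ∧
      muI τ ≤ ((2 + 2 * Real.log (y : ℝ) / (Real.log (x : ℝ) - 2 * Real.log (y : ℝ)) : ℝ) : EReal) := by
  have hx0 : (0 : ℝ) < x := by exact_mod_cast hx
  have hy0 : (0 : ℝ) < y := by exact_mod_cast hy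
  have hxq : (0 : ℚ) < x := by exact_mod_cast hx
  have hyq : (0 : ℚ) < y := by exact_mod_cast hy
  have ha1 : (1 : ℚ) ≤ (x : ℚ) / y := by
    rw [le_div_iff₀ hyq, one_mul]
    exact_mod_cast (by nlinarith : y ≤ x)
  have hlog : 0 < Real.log x - 2 * Real.log y := by
    have h : Real.log ((y : ℝ) ^ 2) < Real.log x :=
      Real.log_lt_log (by positivity) (by exact_mod_cast hxy)
    rw [Real.log_pow] at h
    push_cast at h
    linarith
  have hlogy : 0 ≤ Real.log y := Real.log_nonneg (by exact_mod_cast hy)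
  set b : ℕ → ℚ := fun n => (if Odd n then u else v) * ((x : ℚ) / (y : ℚ)) ^ n with hbdef
  have hb0 : ∀ n, 0 < b n := fun n => by
    simp only [hbdef]
    split_ifs <;> positivity
  obtain ⟨w, hw0, hwu, hwv⟩ : ∃ w : ℚ, 0 < w ∧ w ≤ u ∧ w ≤ v :=
    ⟨min u v, lt_min hu hv, min_le_left _ _, min_le_right _ _⟩
  obtain ⟨W, hW0, huW, hvW⟩ : ∃ W : ℚ, 0 < W ∧ u ≤ W ∧ v ≤ W :=
    ⟨max u v, lt_max_of_lt_left hu, le_max_left _ _, le_max_right _ _⟩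
  have hbW : ∀ n, b n ≤ W * ((x : ℚ) / y) ^ n := fun n => by
    simp only [hbdef]
    gcongr
    split_ifs <;> assumption
  have hwb : ∀ n, w * ((x : ℚ) / y) ^ n ≤ b n := fun n => by
    simp only [hbdef]
    gcongr
    split_ifs <;> assumption
  set D : ℕ := u.den * v.den with hD
  have hD0 : 0 < D := Nat.mul_pos u.pos v.pos
  have hDr : (0 : ℝ) < D := by exact_mod_cast hD0
  have hDq : (0 : ℚ) < D := by exact_mod_cast hD0
  have hbint : ∀ n, ∃ z : ℤ, (D : ℚ) * y ^ n * b n = z := by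
    intro n
    have hun : u * u.den = u.num := Rat.mul_den_eq_num u
    have hvn : v * v.den = v.num := Rat.mul_den_eq_num v
    simp only [hbdef, hD]
    split_ifs
    · refine ⟨u.num * v.den * x ^ n, ?_⟩
      push_cast
      rw [← hun]
      field_simp
      rw [← mul_pow, mul_div_cancel₀ _ hyq.ne']
    · refine ⟨v.num * u.den * x ^ n, ?_⟩
      push_cast
      rw [← hvn]
      field_simp
      rw [← mul_pow, mul_div_cancel₀ _ hyq.ne']
  have hintA := recurrence_integral (f := cfAQ (fun _ => 1) b) (fun n => cfAQ.eq_3 _ b n) hbint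
    ⟨0, by simp [cfAQ]⟩ ⟨D * y, by simp [cfAQ]⟩
  have hintB := recurrence_integral (f := cfBQ (fun _ => 1) b) (fun n => cfBQ.eq_3 _ b n) hbint
    ⟨1, by simp [cfBQ]⟩ (by simpa [cfBQ] using hbint 1)
  choose p hp using hintA
  choose q hq using hintB
  have hpr : ∀ n, (D : ℝ) ^ n * y ^ tri n * cfAQ (fun _ => 1) b n = p n := fun n => by
    exact_mod_cast congrArg (Rat.cast (K := ℝ)) (hp n)
  have hqr : ∀ n, (D : ℝ) ^ n * y ^ tri n * cfBQ (fun _ => 1) b n = q n := fun n => by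
    exact_mod_cast congrArg (Rat.cast (K := ℝ)) (hq n)
  have hdet : ∀ n, p n * q (n + 1) ≠ p (n + 1) * q n := by
    intro n h
    have h' : (p n : ℚ) * q (n + 1) = p (n + 1) * q n := by exact_mod_cast h
    rw [← hp, ← hp, ← hq, ← hq] at h'
    have hd := cf_det b n
    have hz : ((D : ℚ) ^ n * y ^ tri n * (D ^ (n + 1) * y ^ tri (n + 1))) * (-1) ^ n = 0 := by
      rw [← hd]
      linear_combination -h'
    have hne : ((D : ℚ) ^ n * y ^ tri n * (D ^ (n + 1) * y ^ tri (n + 1))) ≠ 0 := by positivity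
    rcases mul_eq_zero.1 hz with h1 | h1
    · exact hne h1
    · exact pow_ne_zero n (by norm_num) h1
  have hWr : (0 : ℝ) < (W : ℝ) + 1 := by
    have : (0 : ℝ) < W := by exact_mod_cast hW0
    linarith
  have hwr : (0 : ℝ) < w := by exact_mod_cast hw0
  have hup : ∀ n, (cfBQ (fun _ => 1) b n : ℝ) ≤ ((W : ℝ) + 1) ^ n * ((x : ℝ) / y) ^ tri n :=
    fun n => by
      have h := (Rat.cast_le (K := ℝ)).2 (cf_le_pow ha1 hW0.le hb0 hbW n)
      push_cast at h
      exact h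
  have hlow : ∀ n, (w : ℝ) ^ n * ((x : ℝ) / y) ^ tri n ≤ (cfBQ (fun _ => 1) b n : ℝ) :=
    fun n => by
      have h := (Rat.cast_le (K := ℝ)).2 (pow_le_cf (zero_le_one.trans ha1) hw0.le hb0 hwb n)
      push_cast at h
      exact h
  have hBpos : ∀ n, (0 : ℝ) < cfBQ (fun _ => 1) b n := fun n => by exact_mod_cast cf_pos hb0 n
  have hpow : ∀ {z : ℝ}, 0 < z → ∀ n : ℕ, z ^ n = Real.exp (n * Real.log z) := by
    intro z hz n
    rw [mul_comm, ← Real.rpow_def_of_pos hz, Real.rpow_natCast]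
  have hxylog : Real.log ((x : ℝ) / y) = Real.log x - Real.log y :=
    Real.log_div hx0.ne' hy0.ne'
  have hlxy : 0 < Real.log x - Real.log y := by linarith
  have hlowexp : ∀ n : ℕ, Real.exp (n * Real.log w +
      (((n : ℝ) ^ 2 + n) / 2) * (Real.log x - Real.log y)) ≤ (cfBQ (fun _ => 1) b n : ℝ) := by
    intro n
    refine le_trans (le_of_eq ?_) (hlow n)
    rw [hpow hwr, hpow (div_pos hx0 hy0), hxylog, tri_cast, ← Real.exp_add]
  have hBtop : Tendsto (fun n => (cfBQ (fun _ => 1) b n : ℝ)) atTop atTop := by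
    refine tendsto_atTop_mono hlowexp (Real.tendsto_exp_atTop.comp ?_)
    have h1 : Tendsto (fun n : ℕ => (n : ℝ) * ((Real.log x - Real.log y) / 2) +
        (Real.log w + (Real.log x - Real.log y) / 2)) atTop atTop :=
      tendsto_atTop_add_const_right _ _
        (tendsto_natCast_atTop_atTop.atTop_mul_const (by linarith))
    refine ((tendsto_natCast_atTop_atTop (R := ℝ)).atTop_mul_atTop₀ h1).congr fun n => ?_
    ring
  obtain ⟨τ, hτ, herr⟩ := cf_exists_limit hb0
    (hBtop.atTop_mul_atTop₀ ((tendsto_add_atTop_iff_nat 1).2 hBtop))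
  have hbound : ∀ μ : ℝ, 2 + 2 * Real.log y / (Real.log x - 2 * Real.log y) < μ →
      ∃ N₀ > (0 : ℝ), ∀ M N : ℤ, (N : ℝ) ≥ N₀ →
        |τ - (M : ℝ) / (N : ℝ)| ≥ 1 / (N : ℝ) ^ μ := by
    intro μ hμ
    refine exists_lower_bound_of_linear_forms (α := Real.log x / 2)
      (β := (Real.log x - 2 * Real.log y) / 2)
      (c := Real.log D + Real.log (W + 1) + Real.log x / 2) (d := 0)
      (e := Real.log D + Real.log y / 2 - Real.log w - 3 / 2 * (Real.log x - Real.log y))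
      (f := - Real.log w - (Real.log x - Real.log y))
      (by linarith) (by linarith) p q hdet (fun n => ?_) (fun n => ?_) ?_
    · rw [← hqr, abs_of_pos (by have := hBpos n; positivity)]
      calc (D : ℝ) ^ n * y ^ tri n * cfBQ (fun _ => 1) b n
          ≤ (D : ℝ) ^ n * y ^ tri n * (((W : ℝ) + 1) ^ n * ((x : ℝ) / y) ^ tri n) := by
            have := hup n
            gcongr
        _ = _ := by
            rw [hpow hDr, hpow hy0, hpow hWr, hpow (div_pos hx0 hy0), hxylog, tri_cast,
              ← Real.exp_add, ← Real.exp_add, ← Real.exp_add]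
            congr 1
            ring
    · have heq : (q n : ℝ) * τ - p n = (D : ℝ) ^ n * y ^ tri n *
          (cfBQ (fun _ => 1) b n * τ - cfAQ (fun _ => 1) b n) := by
        rw [← hpr, ← hqr]
        ring
      rw [heq, abs_mul, abs_of_pos (by positivity)]
      calc _ ≤ (D : ℝ) ^ n * y ^ tri n * (1 / Real.exp ((n + 1 : ℕ) * Real.log w +
            ((((n + 1 : ℕ) : ℝ) ^ 2 + (n + 1 : ℕ)) / 2) * (Real.log x - Real.log y))) := by
            have h1 := herr n
            have h2 := one_div_le_one_div_of_le (Real.exp_pos _) (hlowexp (n + 1))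
            have h3 := h1.trans h2
            gcongr
        _ = _ := by
            rw [hpow hDr, hpow hy0, tri_cast, one_div, ← Real.exp_neg, ← Real.exp_add,
              ← Real.exp_add]
            congr 1
            push_cast
            ring
    · convert hμ using 1
      field_simp
      ring
  refine ⟨τ, hτ, irrational_of_lower_bound (hbound _ (lt_add_one _)), ?_⟩
  refine EReal.le_of_forall_lt_iff_le.1 fun μ hμ => ?_
  obtain ⟨N₀, hN₀, h⟩ := hbound μ (EReal.coe_lt_coe_iff.1 hμ)
  exact sInf_le ⟨μ, ⟨1, one_pos, N₀, hN₀, h⟩, rfl⟩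
end

section
/- Let (T_n) be the Tribonacci sequence defined by T_0 = 0, T_1 = 0, T_2 = 1 and T_{n+3} = T_{n+2} + T_{n+1} + T_n for n ≥ 0, and let l, k be integers with 1 ≤ l < k. Then the generalized continued fraction τ = K_{n=2}^∞ T_{n^l}/T_{n^k}, with partial numerators a_n = T_{n^l} and partial denominators b_n = T_{n^k} for n ≥ 2, converges to an irrational number τ with μ_I(τ) = 2. -/
open Filter

/-- Numerators of the convergents of the generalized continued fraction
`K_{n=1}^∞ a n / b n`. -/
def cfA (a b : ℕ → ℤ) : ℕ → ℤ
  | 0 => 0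
  | 1 => a 1
  | (n + 2) => b (n + 2) * cfA a b (n + 1) + a (n + 2) * cfA a b n

/-- Denominators of the convergents of the generalized continued fraction
`K_{n=1}^∞ a n / b n`. -/
def cfB (a b : ℕ → ℤ) : ℕ → ℤ
  | 0 => 1
  | 1 => b 1
  | (n + 2) => b (n + 2) * cfB a b (n + 1) + a (n + 2) * cfB a b n

/-- The Tribonacci sequence: `T₀ = T₁ = 0`, `T₂ = 1`,
`T_{n+3} = T_{n+2} + T_{n+1} + T_n`. -/
def trib : ℕ → ℤ
  | 0 => 0
  | 1 => 0
  | 2 => 1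
  | (n + 3) => trib (n + 2) + trib (n + 1) + trib n

section Approximation

/-- A real number with integer approximations `A n / B n` that are consecutively distinct, where
`B n → ∞` and `|B n * τ - A n| ≤ B n ^ (-1 + ε)` eventually, for each `ε > 0`, is irrational. -/
theorem irrational_of_approx {τ : ℝ} {A B : ℕ → ℤ}
    (htop : Tendsto (fun n => (B n : ℝ)) atTop atTop)
    (hdet : ∀ n, A (n + 1) * B n ≠ A n * B (n + 1))
    (happ : ∀ ε > (0 : ℝ), ∀ᶠ n in atTop, |(B n : ℝ) * τ - A n| ≤ (B n : ℝ) ^ (-1 + ε)) :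
    Irrational τ := by
  rintro ⟨q, rfl⟩
  have hq : (0 : ℝ) < q.den := by exact_mod_cast q.den_pos
  have hlim : Tendsto (fun n => (q.den : ℝ) * (B n : ℝ) ^ (-(1 / 2 : ℝ))) atTop (nhds 0) := by
    simpa using ((tendsto_rpow_neg_atTop (by norm_num : (0 : ℝ) < 1 / 2)).comp htop).const_mul
      (q.den : ℝ)
  have hzero : ∀ᶠ n in atTop, B n * q.num = A n * q.den := by
    filter_upwards [happ (1 / 2) (by norm_num), hlim.eventually_lt_const one_pos] with n h1 h2
    norm_num at h1 h2
    have h3 : |((B n * q.num - A n * q.den : ℤ) : ℝ)| < 1 := by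
      have : ((B n * q.num - A n * q.den : ℤ) : ℝ) = q.den * ((B n : ℝ) * q - A n) := by
        push_cast
        have : (q : ℝ) * q.den = q.num := by exact_mod_cast q.mul_den_eq_num
        rw [← this]; ring
      rw [this, abs_mul, abs_of_pos hq]
      exact (mul_le_mul_of_nonneg_left h1 hq.le).trans_lt h2
    rw [← Int.cast_abs] at h3
    have h4 : |B n * q.num - A n * q.den| < 1 := by exact_mod_cast h3
    exact sub_eq_zero.mp (Int.abs_lt_one_iff.mp h4)
  obtain ⟨n, h1, h2⟩ := (hzero.and ((tendsto_add_atTop_nat 1).eventually hzero)).exists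
  apply hdet n
  have hq' : (q.den : ℤ) ≠ 0 := by exact_mod_cast q.den_ne_zero
  apply mul_right_cancel₀ hq'
  linear_combination B (n + 1) * h1 - B n * h2

/-- Good rational approximations with denominators tending to infinity force any admissible
exponent to be at least `2`. -/
theorem two_le_of_approx {τ : ℝ} {A B : ℕ → ℤ}
    (hB : ∀ n, 0 < B n) (htop : Tendsto (fun n => (B n : ℝ)) atTop atTop)
    (happ : ∀ ε > (0 : ℝ), ∀ᶠ n in atTop, |(B n : ℝ) * τ - A n| ≤ (B n : ℝ) ^ (-1 + ε))
    {μ c N₀ : ℝ} (hc : 0 < c)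
    (h : ∀ M N : ℤ, (N : ℝ) ≥ N₀ → |τ - (M : ℝ) / (N : ℝ)| ≥ c / (N : ℝ) ^ μ) :
    2 ≤ μ := by
  by_contra! hμ
  have hlim : Tendsto (fun n => (B n : ℝ) ^ ((2 - μ) / 2)) atTop atTop :=
    (tendsto_rpow_atTop (by linarith)).comp htop
  obtain ⟨n, h1, h2, h3⟩ := ((happ ((2 - μ) / 2) (by linarith)).and
    ((htop.eventually_ge_atTop N₀).and (hlim.eventually_gt_atTop (1 / c)))).exists
  have hBn : (0 : ℝ) < B n := by exact_mod_cast hB n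
  have h4 := h (A n) (B n) h2
  have h5 : |(B n : ℝ) * τ - A n| = B n * |τ - (A n : ℝ) / B n| := by
    rw [← abs_of_pos hBn, ← abs_mul, abs_of_pos hBn]
    congr 1
    field_simp
  have h6 : (B n : ℝ) * (c / (B n : ℝ) ^ μ) ≤ (B n : ℝ) ^ (-1 + (2 - μ) / 2) := by
    rw [h5] at h1
    exact (mul_le_mul_of_nonneg_left h4 hBn.le).trans h1
  have h7 : (B n : ℝ) * (c / (B n : ℝ) ^ μ) = c * (B n : ℝ) ^ ((2 - μ) / 2)
      * (B n : ℝ) ^ (-1 + (2 - μ) / 2) := by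
    rw [mul_assoc, ← Real.rpow_add hBn,
      show (2 - μ) / 2 + (-1 + (2 - μ) / 2) = 1 - μ by ring, Real.rpow_sub hBn, Real.rpow_one]
    ring
  have h8 : (0 : ℝ) < (B n : ℝ) ^ (-1 + (2 - μ) / 2) := Real.rpow_pos_of_pos hBn _
  rw [h7] at h6
  have h9 : 1 < c * (B n : ℝ) ^ ((2 - μ) / 2) := by
    rw [div_lt_iff₀ hc] at h3; linarith
  nlinarith

/-- If the denominators of good, consecutively distinct rational approximations do not grow too
fast, then every exponent larger than `2` is admissible. -/
theorem exists_lower_bound_of_approx {τ : ℝ} {A B : ℕ → ℤ}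
    (hB : ∀ n, 0 < B n) (hmono : Monotone B) (htop : Tendsto (fun n => (B n : ℝ)) atTop atTop)
    (hdet : ∀ n, A (n + 1) * B n ≠ A n * B (n + 1))
    (happ : ∀ ε > (0 : ℝ), ∀ᶠ n in atTop, |(B n : ℝ) * τ - A n| ≤ (B n : ℝ) ^ (-1 + ε))
    (hgrow : ∀ ε > (0 : ℝ), ∀ᶠ n in atTop, (B (n + 1) : ℝ) ≤ (B n : ℝ) ^ (1 + ε))
    {μ : ℝ} (hμ : 2 < μ) :
    ∃ c > (0 : ℝ), ∃ N₀ > (0 : ℝ), ∀ M N : ℤ,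
      (N : ℝ) ≥ N₀ → |τ - (M : ℝ) / (N : ℝ)| ≥ c / (N : ℝ) ^ μ := by
  obtain ⟨δ, hδ, rfl⟩ : ∃ δ > 0, μ = 2 + δ := ⟨μ - 2, by linarith, by ring⟩
  obtain ⟨ε, hε, hε1, hεδ⟩ : ∃ ε > 0, ε < 1 ∧ (1 + ε) * (1 + ε) ≤ (1 - ε) * (1 + δ) := by
    have h1 : δ / (4 + δ) < 1 := by rw [div_lt_one (by linarith)]; linarith
    have h0 : 0 < δ / (4 + δ) := by positivity
    refine ⟨δ / (4 + δ), h0, h1, ?_⟩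
    have h2 : δ / (4 + δ) * (4 + δ) = δ := div_mul_cancel₀ _ (by linarith)
    nlinarith
  have hB' : ∀ n, (0 : ℝ) < B n := fun n => by exact_mod_cast hB n
  have hB1 : ∀ n, (1 : ℝ) ≤ B n := fun n => by exact_mod_cast hB n
  obtain ⟨n₀, hn₀⟩ := eventually_atTop.mp ((happ ε hε).and (hgrow ε hε))
  refine ⟨2⁻¹ * ((2 : ℝ) ^ (1 + δ))⁻¹, by positivity, (B n₀ : ℝ) ^ (1 - ε),
    Real.rpow_pos_of_pos (hB' _) _, fun M N hN => ?_⟩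
  have hN0 : (0 : ℝ) < N := (Real.rpow_pos_of_pos (hB' n₀) _).trans_le hN
  have hex : ∃ n, 2 * (N : ℝ) < (B n : ℝ) ^ (1 - ε) :=
    (((tendsto_rpow_atTop (by linarith : 0 < 1 - ε)).comp htop).eventually_gt_atTop _).exists
  have hpow_mono : ∀ {m n}, m ≤ n → (B m : ℝ) ^ (1 - ε) ≤ (B n : ℝ) ^ (1 - ε) := fun hmn =>
    Real.rpow_le_rpow (hB' _).le (by exact_mod_cast hmono hmn) (by linarith)
  classical
  obtain ⟨p, hp0, hp1, hp2⟩ : ∃ p, n₀ ≤ p ∧ (B p : ℝ) ^ (1 - ε) ≤ 2 * N ∧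
      2 * N < (B (p + 1) : ℝ) ^ (1 - ε) := by
    have hlt : n₀ < Nat.find hex := by
      by_contra! hle
      have := (Nat.find_spec hex).trans_le (hpow_mono hle)
      linarith
    refine ⟨Nat.find hex - 1, by omega, ?_, ?_⟩
    · exact not_lt.mp (Nat.find_min hex (by omega))
    · rw [Nat.sub_add_cancel (by omega)]
      exact Nat.find_spec hex
  have key : ∀ m, p + 1 ≤ m → A m * N ≠ B m * M → 1 / 2 ≤ B m * (N * |τ - (M : ℝ) / N|) := by
    intro m hm hne
    have h1 : (1 : ℝ) ≤ |((B m * M - A m * N : ℤ) : ℝ)| := by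
      rw [← Int.cast_abs]
      exact_mod_cast Int.one_le_abs (sub_ne_zero.mpr hne.symm)
    have h2 : ((B m * M - A m * N : ℤ) : ℝ)
        = N * ((B m : ℝ) * τ - A m) - B m * (N * (τ - (M : ℝ) / N)) := by
      push_cast; field_simp; ring
    have h3 := abs_sub (N * ((B m : ℝ) * τ - A m)) (B m * (N * (τ - (M : ℝ) / N)))
    rw [← h2, abs_mul, abs_mul (B m : ℝ), abs_mul (N : ℝ) (τ - _), abs_of_pos hN0,
      abs_of_pos (hB' m)] at h3
    have h4 := (hn₀ m (by omega)).1
    have h5 : 2 * N < (B m : ℝ) ^ (1 - ε) := hp2.trans_le (hpow_mono hm)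
    have h6 : (B m : ℝ) ^ (-1 + ε) * (B m : ℝ) ^ (1 - ε) = 1 := by
      rw [← Real.rpow_add (hB' m)]; norm_num
    have h7 : (0 : ℝ) < (B m : ℝ) ^ (-1 + ε) := Real.rpow_pos_of_pos (hB' m) _
    have h8 : N * |(B m : ℝ) * τ - A m| ≤ 1 / 2 := by nlinarith
    linarith
  have hkey : 1 / 2 ≤ (B (p + 2) : ℝ) * (N * |τ - (M : ℝ) / N|) := by
    by_cases hne : A (p + 1) * N = B (p + 1) * M
    · apply key (p + 2) (by omega)
      intro hne'
      apply hdet (p + 1)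
      have hNz : N ≠ 0 := by rintro rfl; simp at hN0
      apply mul_right_cancel₀ hNz
      linear_combination B (p + 1) * hne' - B (p + 2) * hne
    · refine (key (p + 1) le_rfl hne).trans ?_
      have : (B (p + 1) : ℝ) ≤ B (p + 2) := by exact_mod_cast hmono (by omega)
      gcongr
  have hbound : (B (p + 2) : ℝ) ≤ (2 * N) ^ (1 + δ) := by
    calc (B (p + 2) : ℝ) ≤ (B (p + 1) : ℝ) ^ (1 + ε) := (hn₀ (p + 1) (by omega)).2
      _ ≤ ((B p : ℝ) ^ (1 + ε)) ^ (1 + ε) :=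
          Real.rpow_le_rpow (hB' _).le (hn₀ p hp0).2 (by linarith)
      _ = (B p : ℝ) ^ ((1 + ε) * (1 + ε)) := by rw [← Real.rpow_mul (hB' _).le]
      _ ≤ (B p : ℝ) ^ ((1 - ε) * (1 + δ)) := Real.rpow_le_rpow_of_exponent_le (hB1 p) hεδ
      _ = ((B p : ℝ) ^ (1 - ε)) ^ (1 + δ) := by rw [← Real.rpow_mul (hB' _).le]
      _ ≤ (2 * N) ^ (1 + δ) :=
          Real.rpow_le_rpow (Real.rpow_nonneg (hB' _).le _) hp1 (by linarith)
  have hN2 : (N : ℝ) ^ (2 + δ) = N * (N : ℝ) ^ (1 + δ) := by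
    rw [show 2 + δ = 1 + (1 + δ) by ring, Real.rpow_add hN0, Real.rpow_one]
  rw [ge_iff_le, div_le_iff₀ (Real.rpow_pos_of_pos hN0 _), hN2]
  rw [Real.mul_rpow (by norm_num) hN0.le] at hbound
  have h2p : (0 : ℝ) < 2 ^ (1 + δ) := by positivity
  rw [← div_eq_mul_inv, div_le_iff₀ h2p]
  have : (B (p + 2) : ℝ) * (N * |τ - (M : ℝ) / N|)
      ≤ 2 ^ (1 + δ) * (N : ℝ) ^ (1 + δ) * (N * |τ - (M : ℝ) / N|) := by gcongr
  linarith

theorem muI_eq_two_of_approx {τ : ℝ} {A B : ℕ → ℤ}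
    (hB : ∀ n, 0 < B n) (hmono : Monotone B) (htop : Tendsto (fun n => (B n : ℝ)) atTop atTop)
    (hdet : ∀ n, A (n + 1) * B n ≠ A n * B (n + 1))
    (happ : ∀ ε > (0 : ℝ), ∀ᶠ n in atTop, |(B n : ℝ) * τ - A n| ≤ (B n : ℝ) ^ (-1 + ε))
    (hgrow : ∀ ε > (0 : ℝ), ∀ᶠ n in atTop, (B (n + 1) : ℝ) ≤ (B n : ℝ) ^ (1 + ε)) :
    muI τ = ((2 : ℝ) : EReal) := by
  apply le_antisymm
  · by_contra! hlt
    obtain ⟨μ, h1, h2⟩ := EReal.lt_iff_exists_real_btwn.mp hlt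
    refine absurd h2 (not_lt.mpr (sInf_le ⟨μ, ?_, rfl⟩))
    exact exists_lower_bound_of_approx hB hmono htop hdet happ hgrow (EReal.coe_lt_coe_iff.mp h1)
  · apply le_sInf
    rintro _ ⟨μ, ⟨c, hc, N₀, -, h⟩, rfl⟩
    exact EReal.coe_le_coe_iff.mpr (two_le_of_approx hB htop happ hc h)

end Approximation

section ContinuedFraction

variable {a b : ℕ → ℤ}

theorem cfA_mul_cfB_sub (a b : ℕ → ℤ) (n : ℕ) :
    cfA a b (n + 1) * cfB a b n - cfA a b n * cfB a b (n + 1)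
      = (-1) ^ n * ∏ i ∈ Finset.range (n + 1), a (i + 1) := by
  induction n with
  | zero => simp [cfA, cfB]
  | succ n ih =>
    rw [Finset.prod_range_succ, cfA, cfB, pow_succ]
    linear_combination (-a (n + 1 + 1)) * ih

theorem cfB_pos (ha : ∀ n, 0 < a (n + 1)) (hb : ∀ n, 0 < b (n + 1)) (n : ℕ) :
    0 < cfB a b n := by
  induction n using Nat.twoStepInduction with
  | zero => simp [cfB]
  | one => simpa [cfB] using hb 0
  | more n h1 h2 =>
    rw [cfB]
    have := mul_pos (hb (n + 1)) h2
    have := mul_pos (ha (n + 1)) h1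
    linarith

theorem mul_cfB_le (ha : ∀ n, 0 < a (n + 1)) (hb : ∀ n, 0 < b (n + 1)) (n : ℕ) :
    b (n + 1) * cfB a b n ≤ cfB a b (n + 1) := by
  cases n with
  | zero => simp [cfB]
  | succ n =>
    rw [cfB]
    have := mul_pos (ha (n + 1)) (cfB_pos ha hb n)
    linarith

theorem cfB_monotone (ha : ∀ n, 0 < a (n + 1)) (hb : ∀ n, 0 < b (n + 1)) :
    Monotone (cfB a b) :=
  monotone_nat_of_le_succ fun n => by
    have h1 := mul_cfB_le ha hb n
    have h2 := cfB_pos ha hb n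
    have h3 : 1 ≤ b (n + 1) := hb n
    nlinarith

theorem prod_le_cfB (ha : ∀ n, 0 < a (n + 1)) (hb : ∀ n, 0 < b (n + 1)) (n : ℕ) :
    ∏ i ∈ Finset.range n, b (i + 1) ≤ cfB a b n := by
  induction n with
  | zero => simp [cfB]
  | succ n ih =>
    rw [Finset.prod_range_succ, mul_comm]
    exact (mul_le_mul_of_nonneg_left ih (hb n).le).trans (mul_cfB_le ha hb n)

theorem cfB_succ_le (ha : ∀ n, 0 < a (n + 1)) (hab : ∀ n, a (n + 1) ≤ b (n + 1)) (n : ℕ) :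
    cfB a b (n + 1) ≤ 2 * b (n + 1) * cfB a b n := by
  have hb : ∀ n, 0 < b (n + 1) := fun n => (ha n).trans_le (hab n)
  cases n with
  | zero => have := hb 0; simp [cfB] at this ⊢; linarith
  | succ n =>
    have h2 : a (n + 2) * cfB a b n ≤ b (n + 2) * cfB a b (n + 1) :=
      mul_le_mul (hab (n + 1)) (cfB_monotone ha hb n.le_succ) (cfB_pos ha hb n).le (hb (n + 1)).le
    rw [cfB]
    linarith

theorem dist_convergents (ha : ∀ n, 0 < a (n + 1)) (hb : ∀ n, 0 < b (n + 1)) (n : ℕ) :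
    dist ((cfA a b n : ℝ) / cfB a b n) ((cfA a b (n + 1) : ℝ) / cfB a b (n + 1))
      = ((∏ i ∈ Finset.range (n + 1), a (i + 1) : ℤ) : ℝ) / (cfB a b n * cfB a b (n + 1)) := by
  have h0 : (0 : ℝ) < cfB a b n := by exact_mod_cast cfB_pos ha hb n
  have h1 : (0 : ℝ) < cfB a b (n + 1) := by exact_mod_cast cfB_pos ha hb (n + 1)
  have hP : (0 : ℝ) < (∏ i ∈ Finset.range (n + 1), a (i + 1) : ℤ) := by
    exact_mod_cast Finset.prod_pos fun i _ => ha i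
  have h : ((cfA a b (n + 1) : ℝ) * cfB a b n - cfA a b n * cfB a b (n + 1))
      = (-1) ^ n * (∏ i ∈ Finset.range (n + 1), a (i + 1) : ℤ) := by
    exact_mod_cast cfA_mul_cfB_sub a b n
  rw [dist_comm, Real.dist_eq, div_sub_div _ _ h1.ne' h0.ne',
    mul_comm (cfB a b (n + 1) : ℝ) (cfA a b n), h, abs_div, abs_mul, abs_pow, abs_neg, abs_one, one_pow, one_mul, abs_of_pos hP,
    abs_of_pos (mul_pos h1 h0), mul_comm (cfB a b n : ℝ)]

theorem dist_convergents_succ_le (ha : ∀ n, 0 < a (n + 1)) (hab : ∀ n, a (n + 1) ≤ b (n + 1))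
    (n : ℕ) :
    dist ((cfA a b (n + 1) : ℝ) / cfB a b (n + 1)) ((cfA a b (n + 2) : ℝ) / cfB a b (n + 2))
      ≤ dist ((cfA a b n : ℝ) / cfB a b n) ((cfA a b (n + 1) : ℝ) / cfB a b (n + 1)) / 2 := by
  have hb : ∀ n, 0 < b (n + 1) := fun n => (ha n).trans_le (hab n)
  rw [dist_convergents ha hb, dist_convergents ha hb, Finset.prod_range_succ]
  set P := ∏ i ∈ Finset.range (n + 1), a (i + 1)
  have hP : (0 : ℝ) < P := by exact_mod_cast Finset.prod_pos fun i _ => ha i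
  have h0 : (0 : ℝ) < cfB a b n := by exact_mod_cast cfB_pos ha hb n
  have h1 : (0 : ℝ) < cfB a b (n + 1) := by exact_mod_cast cfB_pos ha hb (n + 1)
  have h2 : (0 : ℝ) < cfB a b (n + 1 + 1) := by exact_mod_cast cfB_pos ha hb (n + 2)
  have hle : 2 * (a (n + 1 + 1) * cfB a b n) ≤ cfB a b (n + 1 + 1) := by
    have := mul_le_mul (hab (n + 1)) (cfB_monotone ha hb n.le_succ) (cfB_pos ha hb n).le
      (hb (n + 1)).le
    rw [cfB]
    linarith
  have hle' : 2 * ((a (n + 1 + 1) : ℝ) * cfB a b n) ≤ cfB a b (n + 1 + 1) := by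
    exact_mod_cast hle
  push_cast
  rw [div_div, div_le_div_iff₀ (by positivity) (by positivity)]
  calc (P : ℝ) * a (n + 1 + 1) * (cfB a b n * cfB a b (n + 1) * 2)
      = P * cfB a b (n + 1) * (2 * (a (n + 1 + 1) * cfB a b n)) := by ring
    _ ≤ P * cfB a b (n + 1) * cfB a b (n + 1 + 1) := by gcongr
    _ = _ := by ring

/-- A continued fraction with `0 < a n ≤ b n` converges, with an explicit rate. -/
theorem exists_tendsto_convergents (ha : ∀ n, 0 < a (n + 1)) (hab : ∀ n, a (n + 1) ≤ b (n + 1)) :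
    ∃ τ : ℝ, Tendsto (fun n => (cfA a b n : ℝ) / cfB a b n) atTop (nhds τ) ∧
      ∀ n, |(cfB a b n : ℝ) * τ - cfA a b n|
        ≤ 2 * ((∏ i ∈ Finset.range (n + 1), a (i + 1) : ℤ) : ℝ) / cfB a b (n + 1) := by
  have hb : ∀ n, 0 < b (n + 1) := fun n => (ha n).trans_le (hab n)
  set x : ℕ → ℝ := fun n => (cfA a b n : ℝ) / cfB a b n with hx
  have hgeom : ∀ n m, dist (x (n + m)) (x (n + (m + 1)))
      ≤ 2 * dist (x n) (x (n + 1)) / 2 / 2 ^ m := by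
    intro n m
    induction m with
    | zero => simp
    | succ m ih =>
      have h := dist_convergents_succ_le ha hab (n + m)
      rw [pow_succ, ← div_div]
      exact h.trans (div_le_div_of_nonneg_right ih (by norm_num))
  obtain ⟨τ, hτ⟩ := cauchySeq_tendsto_of_complete (cauchySeq_of_le_geometric_two (f := x)
    (C := 2 * dist (x 0) (x 1)) fun m => by simpa using hgeom 0 m)
  refine ⟨τ, hτ, fun n => ?_⟩
  have hτn : Tendsto (fun m => x (n + m)) atTop (nhds τ) := by
    simpa [add_comm] using (tendsto_add_atTop_iff_nat n).mpr hτ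
  have h := dist_le_of_le_geometric_two_of_tendsto₀ (hgeom n) hτn
  have h0 : (0 : ℝ) < cfB a b n := by exact_mod_cast cfB_pos ha hb n
  have h1 : (0 : ℝ) < cfB a b (n + 1) := by exact_mod_cast cfB_pos ha hb (n + 1)
  rw [add_zero, dist_convergents ha hb, dist_comm, Real.dist_eq] at h
  have h2 : (cfB a b n : ℝ) * τ - cfA a b n = cfB a b n * (τ - x n) := by
    rw [hx]; field_simp
  rw [h2, abs_mul, abs_of_pos h0]
  refine (mul_le_mul_of_nonneg_left h h0.le).trans_eq ?_
  field_simp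

end ContinuedFraction

section Tribonacci

theorem trib_pos_add_two (n : ℕ) : 0 < trib (n + 2) := by
  suffices h : 0 < trib (n + 2) ∧ 0 < trib (n + 3) ∧ 0 < trib (n + 4) from h.1
  induction n with
  | zero => simp [trib]
  | succ n ih =>
    refine ⟨ih.2.1, ih.2.2, ?_⟩
    rw [trib]
    linarith [ih.1, ih.2.1, ih.2.2]

theorem trib_pos {n : ℕ} (hn : 2 ≤ n) : 0 < trib n := by
  obtain ⟨m, rfl⟩ := Nat.exists_eq_add_of_le' hn
  exact trib_pos_add_two m

theorem trib_nonneg : ∀ n, 0 ≤ trib n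
  | 0 => by simp [trib]
  | 1 => by simp [trib]
  | n + 2 => (trib_pos_add_two n).le

theorem trib_monotone : Monotone trib :=
  monotone_nat_of_le_succ fun
    | 0 => by simp [trib]
    | 1 => by simp [trib]
    | n + 2 => by
      rw [trib]
      linarith [trib_nonneg n, trib_nonneg (n + 1)]

theorem trib_le_two_pow (n : ℕ) : trib n ≤ 2 ^ n := by
  suffices h : trib n ≤ 2 ^ n ∧ trib (n + 1) ≤ 2 ^ (n + 1) ∧ trib (n + 2) ≤ 2 ^ (n + 2) from h.1
  induction n with
  | zero => simp [trib]
  | succ n ih =>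
    refine ⟨ih.2.1, ih.2.2, ?_⟩
    rw [trib]
    have : (0 : ℤ) < 2 ^ n := by positivity
    have h := ih
    simp only [pow_succ] at h ⊢
    linarith [h.1, h.2.1, h.2.2]

theorem two_pow_le_trib_pow {n : ℕ} (hn : 4 ≤ n) : (2 : ℤ) ^ n ≤ trib n ^ 4 := by
  obtain ⟨m, rfl⟩ := Nat.exists_eq_add_of_le' hn
  induction m using Nat.twoStepInduction with
  | zero => simp [trib]
  | one => simp [trib]
  | more m h _ =>
    have h1 : 2 * trib (m + 4) ≤ trib (m + 2 + 4) := by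
      have h5 : trib (m + 5) = trib (m + 4) + trib (m + 3) + trib (m + 2) := rfl
      have h6 : trib (m + 2 + 4) = trib (m + 5) + trib (m + 4) + trib (m + 3) := rfl
      linarith [trib_nonneg (m + 3), trib_nonneg (m + 2)]
    have h2 : (2 * trib (m + 4)) ^ 4 ≤ trib (m + 2 + 4) ^ 4 :=
      pow_le_pow_left₀ (by linarith [trib_nonneg (m + 4)]) h1 4
    have h3 := h (by omega)
    have h4 : (0 : ℤ) < 2 ^ (m + 4) := by positivity
    calc (2 : ℤ) ^ (m + 2 + 4) = 4 * 2 ^ (m + 4) := by ring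
      _ ≤ 16 * trib (m + 4) ^ 4 := by linarith
      _ = (2 * trib (m + 4)) ^ 4 := by ring
      _ ≤ _ := h2

end Tribonacci

section PowerSums

theorem succ_pow_succ_le (m k : ℕ) : (m + 1) ^ (k + 1) ≤ m ^ (k + 1) + (k + 1) * (m + 1) ^ k := by
  induction k with
  | zero => simp
  | succ k ih =>
    have h : m ^ (k + 1) ≤ (m + 1) ^ (k + 1) := Nat.pow_le_pow_left m.le_succ _
    calc (m + 1) ^ (k + 1 + 1) = (m + 1) * (m + 1) ^ (k + 1) := by ring
      _ ≤ (m + 1) * (m ^ (k + 1) + (k + 1) * (m + 1) ^ k) := Nat.mul_le_mul_left _ ih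
      _ = m ^ (k + 1 + 1) + m ^ (k + 1) + (k + 1) * (m + 1) ^ (k + 1) := by ring
      _ ≤ m ^ (k + 1 + 1) + (m + 1) ^ (k + 1) + (k + 1) * (m + 1) ^ (k + 1) := by gcongr
      _ = _ := by ring

theorem succ_pow_succ_le_sum (n k : ℕ) :
    (n + 1) ^ (k + 1) ≤ (k + 1) * (∑ i ∈ Finset.range n, (i + 2) ^ k + 1) := by
  induction n with
  | zero => simp
  | succ n ih =>
    rw [Finset.sum_range_succ]
    have := succ_pow_succ_le (n + 1) k
    calc (n + 1 + 1) ^ (k + 1) ≤ (n + 1) ^ (k + 1) + (k + 1) * (n + 1 + 1) ^ k := this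
      _ ≤ (k + 1) * (∑ i ∈ Finset.range n, (i + 2) ^ k + 1) + (k + 1) * (n + 1 + 1) ^ k := by
          gcongr
      _ = _ := by ring

theorem eventually_pow_le_mul_sum (k : ℕ) {ε : ℝ} (hε : 0 < ε) :
    ∀ᶠ n : ℕ in atTop, ((n : ℝ) + 2) ^ k ≤ ε * ∑ i ∈ Finset.range n, ((i : ℝ) + 2) ^ k := by
  filter_upwards [tendsto_natCast_atTop_atTop.eventually_ge_atTop
    (((k : ℝ) + 1) * (1 + 2 ^ k / ε))] with n hn
  set S := ∑ i ∈ Finset.range n, ((i : ℝ) + 2) ^ k with hS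
  have h1 : ((n : ℝ) + 1) ^ (k + 1) ≤ (k + 1) * (S + 1) := by
    rw [hS]
    exact_mod_cast succ_pow_succ_le_sum n k
  have h2 : ((n : ℝ) + 2) ^ k ≤ 2 ^ k * ((n : ℝ) + 1) ^ k := by
    rw [← mul_pow]
    gcongr
    linarith [(Nat.cast_nonneg n : (0 : ℝ) ≤ n)]
  have h3 : (1 : ℝ) ≤ ((n : ℝ) + 1) ^ k :=
    one_le_pow₀ (by linarith [(Nat.cast_nonneg n : (0 : ℝ) ≤ n)])
  have h4 : ((k : ℝ) + 1) * (1 + 2 ^ k / ε) * ((n : ℝ) + 1) ^ k ≤ (k + 1) * (S + 1) := by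
    refine le_trans ?_ h1
    rw [pow_succ, mul_comm]
    gcongr
    linarith
  rw [mul_assoc] at h4
  have h5 := le_of_mul_le_mul_left h4 (by positivity)
  have h6 : 2 ^ k / ε * ((n : ℝ) + 1) ^ k ≤ S := by linarith
  calc ((n : ℝ) + 2) ^ k ≤ 2 ^ k * ((n : ℝ) + 1) ^ k := h2
    _ = ε * (2 ^ k / ε * ((n : ℝ) + 1) ^ k) := by field_simp
    _ ≤ ε * S := by gcongr

end PowerSums

section TribonacciContinuedFraction

variable {l k : ℕ}

theorem two_le_add_two_pow (hl : 1 ≤ l) (n : ℕ) : 2 ≤ (n + 1 + 1) ^ l :=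
  calc 2 ≤ n + 1 + 1 := by omega
    _ ≤ (n + 1 + 1) ^ l := Nat.le_self_pow (by omega) _

theorem two_pow_sum_le_cfB_pow (hl : 1 ≤ l) (hlk : l < k) (n : ℕ) :
    (2 : ℝ) ^ (∑ i ∈ Finset.range n, (i + 2) ^ k) ≤
      (cfB (fun n => trib ((n + 1) ^ l)) (fun n => trib ((n + 1) ^ k)) n : ℝ) ^ 4 := by
  have ha : ∀ n, 0 < trib ((n + 1 + 1) ^ l) := fun n => trib_pos (two_le_add_two_pow hl n)
  have hb : ∀ n, 0 < trib ((n + 1 + 1) ^ k) := fun n =>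
    trib_pos (two_le_add_two_pow (hl.trans hlk.le) n)
  have h := prod_le_cfB (a := fun n => trib ((n + 1) ^ l)) (b := fun n => trib ((n + 1) ^ k))
    ha hb n
  have h0 : 0 ≤ ∏ i ∈ Finset.range n, trib ((i + 1 + 1) ^ k) :=
    Finset.prod_nonneg fun i _ => (hb i).le
  have h1 := pow_le_pow_left₀ h0 h 4
  have h2 : (2 : ℤ) ^ (∑ i ∈ Finset.range n, (i + 2) ^ k)
      ≤ (∏ i ∈ Finset.range n, trib ((i + 1 + 1) ^ k)) ^ 4 := by
    rw [← Finset.prod_pow_eq_pow_sum, ← Finset.prod_pow]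
    refine Finset.prod_le_prod (fun i _ => by positivity) fun i _ => two_pow_le_trib_pow ?_
    calc 4 = 2 ^ 2 := by norm_num
      _ ≤ (i + 2) ^ 2 := Nat.pow_le_pow_left (by omega) _
      _ ≤ (i + 2) ^ k := Nat.pow_le_pow_right (by omega) (by omega)
  exact_mod_cast h2.trans h1

theorem prod_trib_le (hlk : l < k) (n : ℕ) :
    ∏ i ∈ Finset.range (n + 1), trib ((i + 1 + 1) ^ l) ≤ 2 ^ (n + 2) ^ k := by
  have h : ∑ i ∈ Finset.range (n + 1), (i + 1 + 1) ^ l ≤ (n + 2) ^ k := by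
    calc ∑ i ∈ Finset.range (n + 1), (i + 1 + 1) ^ l
        ≤ ∑ i ∈ Finset.range (n + 1), (n + 2) ^ l := by
          refine Finset.sum_le_sum fun i hi => Nat.pow_le_pow_left ?_ _
          have := Finset.mem_range.mp hi
          omega
      _ = (n + 1) * (n + 2) ^ l := by simp
      _ ≤ (n + 2) * (n + 2) ^ l := by gcongr; omega
      _ = (n + 2) ^ (l + 1) := by ring
      _ ≤ (n + 2) ^ k := Nat.pow_le_pow_right (by omega) hlk
  calc ∏ i ∈ Finset.range (n + 1), trib ((i + 1 + 1) ^ l)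
      ≤ ∏ i ∈ Finset.range (n + 1), 2 ^ (i + 1 + 1) ^ l :=
        Finset.prod_le_prod (fun i _ => trib_nonneg _) fun i _ => trib_le_two_pow _
    _ = 2 ^ ∑ i ∈ Finset.range (n + 1), (i + 1 + 1) ^ l := Finset.prod_pow_eq_pow_sum _ _ _
    _ ≤ 2 ^ (n + 2) ^ k := pow_le_pow_right₀ (by norm_num) h

theorem eventually_two_pow_le_cfB_rpow (hl : 1 ≤ l) (hlk : l < k) {ε : ℝ} (hε : 0 < ε) :
    ∀ᶠ n : ℕ in atTop, 2 * (2 : ℝ) ^ (n + 2) ^ k ≤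
      (cfB (fun n => trib ((n + 1) ^ l)) (fun n => trib ((n + 1) ^ k)) n : ℝ) ^ ε := by
  filter_upwards [eventually_pow_le_mul_sum k (ε := ε / 8) (by positivity)] with n hn
  have hB : 0 < cfB (fun n => trib ((n + 1) ^ l)) (fun n => trib ((n + 1) ^ k)) n :=
    cfB_pos (a := fun n => trib ((n + 1) ^ l)) (b := fun n => trib ((n + 1) ^ k))
      (fun n => trib_pos (two_le_add_two_pow hl n))
      (fun n => trib_pos (two_le_add_two_pow (hl.trans hlk.le) n)) n
  have hsum := two_pow_sum_le_cfB_pow hl hlk n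
  set B := cfB (fun n => trib ((n + 1) ^ l)) (fun n => trib ((n + 1) ^ k)) n
  have hB' : (0 : ℝ) ≤ B := by exact_mod_cast hB.le
  have h2 : (2 : ℝ) ≤ 2 ^ (n + 2) ^ k := le_self_pow₀ (by norm_num) (by positivity)
  calc 2 * (2 : ℝ) ^ (n + 2) ^ k ≤ 2 ^ (n + 2) ^ k * 2 ^ (n + 2) ^ k := by gcongr
    _ = (2 : ℝ) ^ (2 * ((n : ℝ) + 2) ^ k) := by
        rw [← pow_add, ← Real.rpow_natCast]
        push_cast
        ring_nf
    _ ≤ (2 : ℝ) ^ ((∑ i ∈ Finset.range n, ((i : ℝ) + 2) ^ k) * (ε / 4)) :=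
        Real.rpow_le_rpow_of_exponent_le (by norm_num) (by linarith)
    _ = ((2 : ℝ) ^ (∑ i ∈ Finset.range n, (i + 2) ^ k)) ^ (ε / 4) := by
        rw [Real.rpow_mul (by norm_num), ← Real.rpow_natCast (2 : ℝ)]
        push_cast
        rfl
    _ ≤ ((B : ℝ) ^ 4) ^ (ε / 4) := Real.rpow_le_rpow (by positivity) hsum (by positivity)
    _ = (B : ℝ) ^ ε := by
        rw [← Real.rpow_natCast, ← Real.rpow_mul hB']
        congr 1
        push_cast
        ring

end TribonacciContinuedFraction

/-- for integers `1 ≤ l < k`, the continued fraction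
`K_{n=2}^∞ T_{n^l} / T_{n^k}` (realized here by the index shift `n ↦ n+1` in
the standard convergent recurrences) converges to an irrational number `τ` with
`μ_I(τ) = 2`. -/
theorem tribonacci_gcf_muI_eq_two
    (l k : ℕ) (hl : 1 ≤ l) (hlk : l < k) :
    ∃ τ : ℝ,
      Tendsto (fun n =>
          ((cfA (fun n => trib ((n + 1) ^ l)) (fun n => trib ((n + 1) ^ k)) n : ℝ) /
           (cfB (fun n => trib ((n + 1) ^ l)) (fun n => trib ((n + 1) ^ k)) n : ℝ)))
        atTop (nhds τ) ∧
      Irrational τ ∧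
      muI τ = ((2 : ℝ) : EReal) := by
  have ha : ∀ n, 0 < trib ((n + 1 + 1) ^ l) := fun n => trib_pos (two_le_add_two_pow hl n)
  have hb : ∀ n, 0 < trib ((n + 1 + 1) ^ k) := fun n =>
    trib_pos (two_le_add_two_pow (hl.trans hlk.le) n)
  have hab : ∀ n, trib ((n + 1 + 1) ^ l) ≤ trib ((n + 1 + 1) ^ k) := fun n =>
    trib_monotone (Nat.pow_le_pow_right (by omega) hlk.le)
  obtain ⟨τ, hτ, herr⟩ := exists_tendsto_convergents (a := fun n => trib ((n + 1) ^ l))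
    (b := fun n => trib ((n + 1) ^ k)) ha hab
  have hG := fun (ε : ℝ) (hε : 0 < ε) => eventually_two_pow_le_cfB_rpow hl hlk hε
  have hpos := cfB_pos (a := fun n => trib ((n + 1) ^ l)) (b := fun n => trib ((n + 1) ^ k)) ha hb
  have hmono := cfB_monotone (a := fun n => trib ((n + 1) ^ l))
    (b := fun n => trib ((n + 1) ^ k)) ha hb
  have hsucc := cfB_succ_le (a := fun n => trib ((n + 1) ^ l))
    (b := fun n => trib ((n + 1) ^ k)) ha hab
  have hdet := cfA_mul_cfB_sub (fun n => trib ((n + 1) ^ l)) (fun n => trib ((n + 1) ^ k))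
  set A := cfA (fun n => trib ((n + 1) ^ l)) (fun n => trib ((n + 1) ^ k))
  set B := cfB (fun n => trib ((n + 1) ^ l)) (fun n => trib ((n + 1) ^ k))
  have hpos' : ∀ n, (0 : ℝ) < B n := fun n => by exact_mod_cast hpos n
  have htop : Tendsto (fun n => (B n : ℝ)) atTop atTop := by
    refine tendsto_atTop_mono' _ ?_ (tendsto_natCast_atTop_atTop (R := ℝ))
    filter_upwards [hG 1 one_pos] with n hn
    rw [Real.rpow_one] at hn
    have h1 : n ≤ 2 ^ (n + 2) ^ k :=
      calc n ≤ n + 2 := by omega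
        _ ≤ (n + 2) ^ k := Nat.le_self_pow (by omega) _
        _ ≤ 2 ^ (n + 2) ^ k := Nat.lt_two_pow_self.le
    have h2 : (n : ℝ) ≤ 2 ^ (n + 2) ^ k := by exact_mod_cast h1
    linarith [(by positivity : (0 : ℝ) < 2 ^ (n + 2) ^ k)]
  have hdet' : ∀ n, A (n + 1) * B n ≠ A n * B (n + 1) := by
    intro n
    rw [← sub_ne_zero, hdet n]
    exact mul_ne_zero (by simp) (Finset.prod_pos fun i _ => ha i).ne'
  have happ : ∀ ε > (0 : ℝ), ∀ᶠ n in atTop, |(B n : ℝ) * τ - A n| ≤ (B n : ℝ) ^ (-1 + ε) := by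
    intro ε hε
    filter_upwards [hG ε hε] with n hn
    have h1 : ((∏ i ∈ Finset.range (n + 1), trib ((i + 1 + 1) ^ l) : ℤ) : ℝ)
        ≤ 2 ^ (n + 2) ^ k := by exact_mod_cast prod_trib_le hlk n
    have h2 : (B n : ℝ) ≤ B (n + 1) := by exact_mod_cast hmono n.le_succ
    calc |(B n : ℝ) * τ - A n|
        ≤ 2 * ((∏ i ∈ Finset.range (n + 1), trib ((i + 1 + 1) ^ l) : ℤ) : ℝ) / B (n + 1) := herr n
      _ ≤ (B n : ℝ) ^ ε / B n :=
          div_le_div₀ (Real.rpow_nonneg (hpos' n).le _) (by linarith) (hpos' n) h2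
      _ = (B n : ℝ) ^ (-1 + ε) := by
          rw [Real.rpow_add (hpos' n), Real.rpow_neg_one]
          ring
  have hgrow : ∀ ε > (0 : ℝ), ∀ᶠ n in atTop, (B (n + 1) : ℝ) ≤ (B n : ℝ) ^ (1 + ε) := by
    intro ε hε
    filter_upwards [hG ε hε] with n hn
    have h1 : (trib ((n + 1 + 1) ^ k) : ℝ) ≤ 2 ^ (n + 2) ^ k := by
      exact_mod_cast trib_le_two_pow _
    have h2 : (B (n + 1) : ℝ) ≤ 2 * trib ((n + 1 + 1) ^ k) * B n := by exact_mod_cast hsucc n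
    rw [add_comm 1 ε, Real.rpow_add (hpos' n), Real.rpow_one]
    have h3 : 2 * (trib ((n + 1 + 1) ^ k) : ℝ) ≤ (B n : ℝ) ^ ε := by linarith
    exact h2.trans (mul_le_mul_of_nonneg_right h3 (hpos' n).le)
  exact ⟨τ, hτ, irrational_of_approx htop hdet' happ,
    muI_eq_two_of_approx hpos hmono htop hdet' happ hgrow⟩
end
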